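/- A univariate real polynomial with exactly 3 monomial terms (a trinomial) has at most 4 nonzero real roots (counted without multiplicity). -/

import Mathlib

/-- A nonzero polynomial with `n` monomial terms has at most `n - 1` sign variations. -/
theorem signVariations_lt_card_support {P : Polynomial ℝ} (hP : P ≠ 0) :
    P.signVariations < P.support.card := by
  induction hn : P.support.card using Nat.strong_induction_on generalizing P with
  | _ n ih =>
    subst hn
    have hlt := Polynomial.card_support_eraseLead_add_one hP
    by_cases h : P.eraseLead = 0
    · have hmono := Polynomial.eraseLead_add_monomial_natDegree_leadingCoeff P
      rw [h, zero_add] at hmono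
      have hzero := Polynomial.signVariations_monomial P.natDegree P.leadingCoeff
      rw [hmono] at hzero
      omega
    · have := ih _ (by omega) h rfl
      have := Polynomial.signVariations_le_eraseLead_succ (P := P)
      omega

/-- A nonzero real polynomial with `n` monomial terms has fewer than `n` distinct positive
roots. -/
theorem encard_pos_roots_lt_card_support {P : Polynomial ℝ} (hP : P ≠ 0) :
    {x : ℝ | 0 < x ∧ P.eval x = 0}.encard < P.support.card := by
  have hset : {x : ℝ | 0 < x ∧ P.eval x = 0} = ((P.roots.filter (0 < ·)).toFinset : Set ℝ) := by
    ext x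
    simp [hP, and_comm]
  rw [hset, Set.encard_coe_eq_coe_finsetCard, Nat.cast_lt]
  calc
    _ ≤ P.roots.countP (0 < ·) := by
      rw [Multiset.countP_eq_card_filter]
      exact Multiset.toFinset_card_le _
    _ ≤ P.signVariations := Polynomial.roots_countP_pos_le_signVariations P
    _ < P.support.card := signVariations_lt_card_support hP

/-- A nonempty sum of `n` real monomials with distinct exponents and nonzero coefficients has
fewer than `n` distinct positive roots. -/
theorem encard_pos_zeros_sum_lt {ι : Type*} [Fintype ι] [Nonempty ι] (c : ι → ℝ)
    (hc : ∀ i, c i ≠ 0) (a : ι → ℕ) (ha : Function.Injective a) :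
    {x : ℝ | 0 < x ∧ ∑ i, c i * x ^ a i = 0}.encard < Fintype.card ι := by
  classical
  set P : Polynomial ℝ := ∑ i, Polynomial.monomial (a i) (c i) with hPdef
  have hcoeff (i : ι) : P.coeff (a i) = c i := by
    simp [hPdef, Polynomial.finsetSum_coeff, Polynomial.coeff_monomial, ha.eq_iff]
  have hP : P ≠ 0 := by
    obtain ⟨i⟩ := ‹Nonempty ι›
    intro h
    exact hc i (by rw [← hcoeff i, h, Polynomial.coeff_zero])
  have hsupp : P.support ⊆ Finset.univ.image a := by
    intro n hn
    by_contra h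
    simp only [Finset.mem_image, Finset.mem_univ, true_and, not_exists] at h
    exact Polynomial.mem_support_iff.mp hn
      (by simp [hPdef, Polynomial.finsetSum_coeff, Polynomial.coeff_monomial, h])
  have hcard : P.support.card ≤ Fintype.card ι :=
    (Finset.card_le_card hsupp).trans Finset.card_image_le
  have heval (x : ℝ) : P.eval x = ∑ i, c i * x ^ a i := by
    simp [hPdef, Polynomial.eval_finsetSum]
  simp only [← heval]
  exact (encard_pos_roots_lt_card_support hP).trans_le (by exact_mod_cast hcard)

/-- A real trinomial `c₁x^{a₁} + c₂x^{a₂} + c₃x^{a₃}` (nonzero coefficients,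
strictly increasing exponents) has at most `4` distinct nonzero real roots. -/
theorem stmt13 (c : Fin 3 → ℝ) (hc : ∀ i, c i ≠ 0) (a : Fin 3 → ℕ) (ha : StrictMono a) :
    {x : ℝ | x ≠ 0 ∧ ∑ i, c i * x ^ a i = 0}.ncard ≤ 4 := by
  have hpos := encard_pos_zeros_sum_lt c hc a ha.injective
  have hneg := encard_pos_zeros_sum_lt (fun i => c i * (-1) ^ a i) (fun i => by simp [hc i]) a
    ha.injective
  set S := {x : ℝ | 0 < x ∧ ∑ i, c i * x ^ a i = 0}
  set T := {x : ℝ | 0 < x ∧ ∑ i, c i * (-1) ^ a i * x ^ a i = 0}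
  have hfinS : S.Finite := Set.finite_of_encard_le_coe hpos.le
  have hfinT : T.Finite := Set.finite_of_encard_le_coe hneg.le
  rw [← hfinS.cast_ncard_eq, Fintype.card_fin, Nat.cast_lt] at hpos
  rw [← hfinT.cast_ncard_eq, Fintype.card_fin, Nat.cast_lt] at hneg
  have hsub : {x : ℝ | x ≠ 0 ∧ ∑ i, c i * x ^ a i = 0} ⊆ S ∪ Neg.neg '' T := by
    rintro x ⟨hx, hroot⟩
    rcases hx.lt_or_gt with hx | hx
    · refine Or.inr ⟨-x, ⟨neg_pos.mpr hx, ?_⟩, neg_neg x⟩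
      simpa [mul_assoc, ← mul_pow] using hroot
    · exact Or.inl ⟨hx, hroot⟩
  have hle := Set.ncard_le_ncard hsub (hfinS.union (hfinT.image _))
  have hunion := Set.ncard_union_le S (Neg.neg '' T)
  have himage := Set.ncard_image_le (f := Neg.neg) hfinT
  omega
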